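/- arXiv:2009.14607 — 2 statements merged into one kernel-verified Lean document; each statement's English description precedes it below -/
import Mathlib

section
/- For any ε, η > 0, there exists a smooth compactly supported function ψ on ℝ with support contained in [-η, η] such that ‖ψ‖_{BMO(ℝ)} < ε, 0 ≤ ψ ≤ 1, and ψ(0) = 1. -/
open MeasureTheory

/-- The mean oscillation of `f` with respect to a measure. -/
noncomputable def meanOsc (P : Measure ℝ) (f : ℝ → ℝ) : ℝ := ∫ x, |f x - ∫ y, f y ∂P| ∂P

lemma meanOsc_sum_le (P : Measure ℝ) [IsProbabilityMeasure P] {ι : Type*} (s : Finset ι)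
    (f : ι → ℝ → ℝ) (hf : ∀ i ∈ s, Integrable (f i) P) :
    meanOsc P (fun x => ∑ i ∈ s, f i x) ≤ ∑ i ∈ s, meanOsc P (f i) := by
  unfold meanOsc
  have hint : ∀ i ∈ s, Integrable (fun x => |f i x - ∫ y, f i y ∂P|) P :=
    fun i hi => ((hf i hi).sub (integrable_const _)).abs
  rw [integral_finsetSum s hf, ← integral_finsetSum s hint]
  refine integral_mono ((integrable_finsetSum s hf).sub (integrable_const _)).abs
    (integrable_finsetSum s hint) fun x => ?_
  simp only [← Finset.sum_sub_distrib]
  exact Finset.abs_sum_le_sum_abs _ _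

lemma meanOsc_const_mul (P : Measure ℝ) (c : ℝ) (f : ℝ → ℝ) :
    meanOsc P (fun x => c * f x) = |c| * meanOsc P f := by
  simp only [meanOsc, integral_const_mul, ← mul_sub, abs_mul]

lemma meanOsc_le_two_mul (P : Measure ℝ) [IsProbabilityMeasure P] {f : ℝ → ℝ}
    (hf : Integrable f P) : meanOsc P f ≤ 2 * ∫ x, |f x| ∂P := by
  calc meanOsc P f ≤ ∫ x, (|f x| + |∫ y, f y ∂P|) ∂P :=
        integral_mono (hf.sub (integrable_const _)).abs (hf.abs.add (integrable_const _))
          fun x => abs_sub _ _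
    _ = (∫ x, |f x| ∂P) + |∫ y, f y ∂P| := by
        rw [integral_add hf.abs (integrable_const _)]; simp
    _ ≤ 2 * ∫ x, |f x| ∂P := by
        linarith [abs_integral_le_integral_abs (f := f) (μ := P)]

lemma meanOsc_le_of_forall_abs_sub_le (P : Measure ℝ) [IsProbabilityMeasure P] {f : ℝ → ℝ}
    (hf : Integrable f P) {s : Set ℝ} (hs : ∀ᵐ x ∂P, x ∈ s) {d : ℝ}
    (hd : ∀ x ∈ s, ∀ y ∈ s, |f x - f y| ≤ d) : meanOsc P f ≤ d := by
  have key : ∀ᵐ x ∂P, |f x - ∫ y, f y ∂P| ≤ d := by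
    filter_upwards [hs] with x hx
    have h1 : f x - ∫ y, f y ∂P = ∫ y, (f x - f y) ∂P := by
      rw [integral_sub (integrable_const _) hf]; simp
    rw [h1]
    refine abs_integral_le_integral_abs.trans ?_
    calc ∫ y, |f x - f y| ∂P ≤ ∫ _, d ∂P := by
          refine integral_mono_ae ((integrable_const _).sub hf).abs (integrable_const _) ?_
          filter_upwards [hs] with y hy using hd x hx y hy
      _ = d := by simp
  calc meanOsc P f ≤ ∫ _, d ∂P :=
        integral_mono_ae (hf.sub (integrable_const _)).abs (integrable_const _) key
    _ = d := by simp

/-- The uniform probability measure on `Ioc a b`. -/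
noncomputable def uniformIoc (a b : ℝ) : Measure ℝ :=
  ((volume.restrict (Set.Ioc a b)) Set.univ)⁻¹ • volume.restrict (Set.Ioc a b)

lemma isProbabilityMeasure_uniformIoc {a b : ℝ} (hab : a < b) :
    IsProbabilityMeasure (uniformIoc a b) := by
  constructor
  have h0 : ENNReal.ofReal (b - a) ≠ 0 := by simpa using hab
  simp only [uniformIoc, Measure.smul_apply, smul_eq_mul, Measure.restrict_apply_univ,
    Real.volume_Ioc]
  exact ENNReal.inv_mul_cancel h0 ENNReal.ofReal_ne_top

lemma integral_uniformIoc {a b : ℝ} (hab : a < b) (f : ℝ → ℝ) :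
    ∫ x, f x ∂(uniformIoc a b) = (b - a)⁻¹ * ∫ x in Set.Ioc a b, f x := by
  rw [uniformIoc, integral_smul_measure]
  simp [ENNReal.toReal_ofReal, hab.le]

lemma ae_mem_uniformIoc (a b : ℝ) : ∀ᵐ x ∂(uniformIoc a b), x ∈ Set.Ioc a b :=
  Measure.ae_smul_measure (ae_restrict_mem measurableSet_Ioc) _

lemma integrable_uniformIoc {a b : ℝ} (hab : a < b) {f : ℝ → ℝ} (hf : Continuous f) :
    Integrable f (uniformIoc a b) :=
  ((hf.integrableOn_Icc).mono_set Set.Ioc_subset_Icc_self).smul_measure (by simpa using hab)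

/-- The dilate `φ (c * ·)` oscillates little over intervals much shorter or much longer
than `1 / c`. -/
lemma meanOsc_dilate_le {φ : ℝ → ℝ} {K : NNReal} (hK : LipschitzWith K φ) (hφ : Integrable φ)
    {a b c : ℝ} (hab : a < b) (hc : 0 < c) :
    meanOsc (uniformIoc a b) (fun x => φ (c * x)) ≤ K * (c * (b - a)) ∧
    meanOsc (uniformIoc a b) (fun x => φ (c * x)) ≤ (2 * ∫ x, |φ x|) / (c * (b - a)) := by
  have := isProbabilityMeasure_uniformIoc hab
  have hint : Integrable (fun x => φ (c * x)) (uniformIoc a b) :=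
    integrable_uniformIoc hab (hK.continuous.comp (continuous_const_mul c))
  have hL : 0 < b - a := sub_pos.2 hab
  constructor
  · refine meanOsc_le_of_forall_abs_sub_le _ hint (ae_mem_uniformIoc a b) fun x hx y hy => ?_
    have h := hK.dist_le_mul (c * x) (c * y)
    rw [Real.dist_eq, Real.dist_eq, ← mul_sub, abs_mul, abs_of_pos hc] at h
    refine h.trans ?_
    gcongr
    rw [abs_le]
    constructor <;> linarith [hx.1, hx.2, hy.1, hy.2]
  · refine (meanOsc_le_two_mul _ hint).trans ?_
    rw [integral_uniformIoc hab]
    have h1 : ∫ x in Set.Ioc a b, |φ (c * x)| ≤ ∫ x, |φ (c * x)| :=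
      setIntegral_le_integral (hφ.comp_mul_left' hc.ne').abs (by filter_upwards; simp)
    rw [Measure.integral_comp_mul_left (fun x => |φ x|) c, abs_of_pos (inv_pos.2 hc),
      smul_eq_mul] at h1
    calc 2 * ((b - a)⁻¹ * ∫ x in Set.Ioc a b, |φ (c * x)|)
        ≤ 2 * ((b - a)⁻¹ * (c⁻¹ * ∫ x, |φ x|)) := by gcongr
      _ = _ := by field_simp

lemma sum_range_le_of_dyadic {M t : ℝ} (hM : 0 ≤ M) (ht : 0 < t) (u : ℕ → ℝ)
    (h₁ : ∀ k, u k ≤ M * (2 ^ k * t)) (h₂ : ∀ k, u k ≤ M / (2 ^ k * t)) (n : ℕ) :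
    ∑ k ∈ Finset.range n, u k ≤ 6 * M := by
  suffices h : ∑ k ∈ Finset.range n, u k ≤ 6 * M / (1 + t) - 6 * M / (1 + 2 ^ n * t) by
    have h₃ : 6 * M / (1 + t) ≤ 6 * M := div_le_self (by positivity) (by linarith)
    have h₄ : 0 ≤ 6 * M / (1 + 2 ^ n * t) := by positivity
    linarith
  induction n with
  | zero => simp
  | succ n ih =>
    rw [Finset.sum_range_succ]
    have h₁ := h₁ n
    have h₂ := h₂ n
    have hpow : (2 : ℝ) ^ (n + 1) * t = 2 * (2 ^ n * t) := by ring
    have hs : 0 < 2 ^ n * t := by positivity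
    rw [hpow]
    generalize 2 ^ n * t = s at *
    have : u n ≤ 6 * M / (1 + s) - 6 * M / (1 + 2 * s) := by
      have e : 6 * M / (1 + s) - 6 * M / (1 + 2 * s) = M * (6 * s / ((1 + s) * (1 + 2 * s))) := by
        field_simp
        ring
      rw [e]
      rcases le_total s 1 with h | h
      · refine h₁.trans (mul_le_mul_of_nonneg_left ?_ hM)
        rw [le_div_iff₀ (by positivity)]
        nlinarith [mul_pos hs hs]
      · refine h₂.trans ?_
        rw [div_eq_mul_inv]
        refine mul_le_mul_of_nonneg_left ?_ hM
        rw [inv_eq_one_div, div_le_div_iff₀ hs (by positivity)]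
        nlinarith
    linarith

/-- Lemma 3.9: for any `ε, η > 0` there is a smooth compactly supported `ψ` on `ℝ` with
support in `[-η, η]`, `0 ≤ ψ ≤ 1`, `ψ(0) = 1` and `‖ψ‖_{BMO(ℝ)} < ε`. -/
theorem exists_smooth_small_bmo (ε η : ℝ) (hε : 0 < ε) (hη : 0 < η) :
    ∃ ψ : ℝ → ℝ, ContDiff ℝ (⊤ : ℕ∞) ψ ∧ HasCompactSupport ψ ∧
      tsupport ψ ⊆ Set.Icc (-η) η ∧ (∀ x, 0 ≤ ψ x ∧ ψ x ≤ 1) ∧ ψ 0 = 1 ∧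
      (⨆ a : ℝ, ⨆ b : ℝ, ⨆ _ : a < b,
        ⨍ x in Set.Ioc a b, |ψ x - ⨍ y in Set.Ioc a b, ψ y|) < ε := by
  let φ : ContDiffBump (0 : ℝ) := ⟨1 / 2, 1, by norm_num, by norm_num⟩
  obtain ⟨K, hK⟩ := (φ.contDiff (n := 1)).lipschitzWith_of_hasCompactSupport
    φ.hasCompactSupport one_ne_zero
  have hφ : Integrable φ := φ.integrable
  set M : ℝ := max K (2 * ∫ x, |φ x|)
  have hM : 0 ≤ M := le_max_of_le_left K.2
  obtain ⟨ℓ, hℓ⟩ := exists_nat_gt (6 * M / (ε / 2))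
  have hℓ₀ : (0 : ℝ) < ℓ := lt_of_le_of_lt (by positivity) hℓ
  have hc : ∀ k : ℕ, 0 < 2 ^ k / η := fun k => by positivity
  let ψ : ℝ → ℝ := fun x => (ℓ : ℝ)⁻¹ * ∑ k ∈ Finset.range ℓ, φ (2 ^ k / η * x)
  have hsupp : ∀ x, x ∉ Set.Icc (-η) η → ψ x = 0 := by
    intro x hx
    have hx' : η < |x| := by
      contrapose! hx
      exact abs_le.1 hx
    have : ∀ k ∈ Finset.range ℓ, φ (2 ^ k / η * x) = 0 := by
      refine fun k _ => φ.zero_of_le_dist ?_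
      change 1 ≤ dist _ _
      rw [dist_zero_right, Real.norm_eq_abs, abs_mul, abs_of_pos (hc k), div_mul_eq_mul_div,
        le_div_iff₀ hη]
      nlinarith [one_le_pow₀ (M₀ := ℝ) one_le_two (n := k), abs_nonneg x]
    simp [ψ, Finset.sum_eq_zero this]
  refine ⟨ψ, ?_, HasCompactSupport.intro isCompact_Icc hsupp, ?_, fun x => ⟨?_, ?_⟩, ?_, ?_⟩
  · exact contDiff_const.mul (ContDiff.sum fun k _ =>
      φ.contDiff.comp (contDiff_const.mul contDiff_id))
  · refine closure_minimal (fun x hx => ?_) isClosed_Icc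
    by_contra h
    exact hx (hsupp x h)
  · exact mul_nonneg (by positivity) (Finset.sum_nonneg fun k _ => φ.nonneg)
  · rw [inv_mul_le_iff₀ hℓ₀, mul_one]
    calc ∑ k ∈ Finset.range ℓ, φ (2 ^ k / η * x) ≤ ∑ _k ∈ Finset.range ℓ, (1 : ℝ) :=
          Finset.sum_le_sum fun k _ => φ.le_one
      _ = ℓ := by simp
  · have : φ 0 = 1 := φ.one_of_mem_closedBall (Metric.mem_closedBall_self φ.rIn_pos.le)
    simp [ψ, this, hℓ₀.ne']
  · refine lt_of_le_of_lt ?_ (half_lt_self hε)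
    have hε₂ : 0 ≤ ε / 2 := by positivity
    refine Real.iSup_le (fun a => Real.iSup_le (fun b => Real.iSup_le (fun hab => ?_) hε₂) hε₂) hε₂
    change meanOsc (uniformIoc a b) ψ ≤ ε / 2
    have := isProbabilityMeasure_uniformIoc hab
    have hL : 0 < b - a := sub_pos.2 hab
    have hscale : ∀ k : ℕ, 2 ^ k / η * (b - a) = 2 ^ k * ((b - a) / η) := fun k => by ring
    have hsum : ∑ k ∈ Finset.range ℓ,
        meanOsc (uniformIoc a b) (fun x => φ (2 ^ k / η * x)) ≤ 6 * M := by
      refine sum_range_le_of_dyadic hM (div_pos hL hη) _ (fun k => ?_) (fun k => ?_) ℓ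
      · refine (meanOsc_dilate_le hK hφ hab (hc k)).1.trans ?_
        rw [hscale]
        gcongr
        exact le_max_left _ _
      · refine (meanOsc_dilate_le hK hφ hab (hc k)).2.trans ?_
        rw [hscale]
        gcongr
        exact le_max_right _ _
    rw [meanOsc_const_mul, abs_of_pos (inv_pos.2 hℓ₀), inv_mul_le_iff₀ hℓ₀]
    refine (meanOsc_sum_le _ _ _ fun k _ => integrable_uniformIoc hab
      (φ.continuous.comp (continuous_const_mul _))).trans (hsum.trans ?_)
    rw [div_lt_iff₀ (by positivity)] at hℓ
    exact hℓ.le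
end

section
/- For any ε > 0 and any smooth compactly supported function g on ℝ^n (n ≥ 1), there exists a smooth compactly supported ψ : ℝ → ℝ with 0 ≤ ψ ≤ 1, ψ(0) = 1, and the BMO(ℝ^n) norm of the function x = (x', x_n) ↦ g(x', 0)ψ(x_n) is less than ε. -/
open MeasureTheory

/-- The mean oscillation of `f` with respect to `P`. -/
noncomputable def meanOscillation {α : Type*} [MeasurableSpace α] (P : Measure α) (f : α → ℝ) : ℝ :=
  ∫ x, |f x - ∫ y, f y ∂P| ∂P

section MeanOscillation

variable {α : Type*} [MeasurableSpace α] {P : Measure α} [IsProbabilityMeasure P]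

lemma meanOscillation_const_mul_sum_le {ι : Type*} (s : Finset ι) (F : ι → α → ℝ) {c : ℝ}
    (hc : 0 ≤ c) (hF : ∀ i ∈ s, Integrable (F i) P) :
    meanOscillation P (fun x => c * ∑ i ∈ s, F i x) ≤ c * ∑ i ∈ s, meanOscillation P (F i) := by
  have hi : ∀ i ∈ s, Integrable (fun x => |F i x - ∫ y, F i y ∂P|) P := fun i h =>
    ((hF i h).sub (integrable_const _)).abs
  unfold meanOscillation
  rw [← integral_finsetSum s hi, ← integral_const_mul, integral_const_mul, integral_finsetSum s hF]
  refine integral_mono (((integrable_finsetSum s hF).const_mul c).sub (integrable_const _)).abs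
    ((integrable_finsetSum s hi).const_mul c) fun x => ?_
  dsimp only
  rw [← mul_sub, abs_mul, abs_of_nonneg hc, ← Finset.sum_sub_distrib]
  exact mul_le_mul_of_nonneg_left (Finset.abs_sum_le_sum_abs _ _) hc

lemma meanOscillation_le_two_mul_integral_abs {f : α → ℝ} (hf : Integrable f P) :
    meanOscillation P f ≤ 2 * ∫ x, |f x| ∂P := by
  have h : meanOscillation P f ≤ ∫ x, (|f x| + |∫ y, f y ∂P|) ∂P :=
    integral_mono (hf.sub (integrable_const _)).abs (hf.abs.add (integrable_const _))
      fun x => abs_sub _ _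
  rw [integral_add hf.abs (integrable_const _), integral_const, probReal_univ, one_smul] at h
  linarith [abs_integral_le_integral_abs (f := f) (μ := P)]

lemma meanOscillation_le_of_abs_sub_le {f : α → ℝ} (hf : Integrable f P) {s : Set α}
    (hs : ∀ᵐ x ∂P, x ∈ s) {K : ℝ} (hK : ∀ x ∈ s, ∀ y ∈ s, |f x - f y| ≤ K) :
    meanOscillation P f ≤ K := by
  have h : ∀ᵐ x ∂P, |f x - ∫ y, f y ∂P| ≤ K := by
    filter_upwards [hs] with x hx
    have e : f x - ∫ y, f y ∂P = ∫ y, (f x - f y) ∂P := by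
      rw [integral_sub (integrable_const _) hf, integral_const, probReal_univ, one_smul]
    rw [e]
    have := norm_integral_le_of_norm_le_const (μ := P) (f := fun y => f x - f y) (C := K)
      (by filter_upwards [hs] with y hy using hK x hx y hy)
    simpa using this
  have := integral_mono_ae (hf.sub (integrable_const _)).abs (integrable_const K) h
  simpa [meanOscillation] using this

end MeanOscillation

lemma min_self_inv_le {y : ℝ} (hy : 0 < y) :
    min y y⁻¹ ≤ 6 * (2 * y / (1 + 2 * y) - y / (1 + y)) := by
  have e : 6 * (2 * y / (1 + 2 * y) - y / (1 + y)) = 6 * y / ((1 + 2 * y) * (1 + y)) := by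
    field_simp
    ring
  rw [e, le_div_iff₀ (by positivity)]
  rcases le_total y 1 with h | h
  · have : min y y⁻¹ ≤ y := min_le_left _ _
    have h6 : (1 + 2 * y) * (1 + y) ≤ 6 := by nlinarith
    calc _ ≤ y * 6 := by gcongr
      _ = _ := by ring
  · have h6 : (1 + 2 * y) * (1 + y) ≤ 6 * y * y := by nlinarith
    calc _ ≤ y⁻¹ * (6 * y * y) := by gcongr; exact min_le_right _ _
      _ = _ := by field_simp

lemma sum_min_two_pow_mul_le (N : ℕ) {x : ℝ} (hx : 0 < x) :
    ∑ k ∈ Finset.range N, min (2 ^ k * x) (2 ^ k * x)⁻¹ ≤ 6 := by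
  set h : ℕ → ℝ := fun k => 2 ^ k * x / (1 + 2 ^ k * x) with hh
  calc _ ≤ ∑ k ∈ Finset.range N, 6 * (h (k + 1) - h k) := by
        refine Finset.sum_le_sum fun k _ => ?_
        have := min_self_inv_le (y := 2 ^ k * x) (by positivity)
        simpa only [hh, pow_succ', mul_assoc] using this
    _ = 6 * (h N - h 0) := by rw [← Finset.mul_sum, Finset.sum_range_sub]
    _ ≤ 6 := by
        have h0 : 0 ≤ h 0 := by simp only [hh]; positivity
        have h1 : h N ≤ 1 := by
          simp only [hh]
          rw [div_le_one (by positivity)]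
          linarith
        linarith

/-- The half-open cube of side `ℓ` with lowest corner `(c, a)`. -/
def cube {m : ℕ} (c : Fin m → ℝ) (a ℓ : ℝ) : Set ((Fin m → ℝ) × ℝ) :=
  (Set.univ.pi fun i => Set.Ioc (c i) (c i + ℓ)) ×ˢ Set.Ioc a (a + ℓ)

/-- The normalized Lebesgue measure on `cube c a ℓ`. -/
noncomputable def cubeMeasure {m : ℕ} (c : Fin m → ℝ) (a ℓ : ℝ) : Measure ((Fin m → ℝ) × ℝ) :=
  (volume.restrict (cube c a ℓ) Set.univ)⁻¹ • volume.restrict (cube c a ℓ)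

section Cube

variable {m : ℕ} (c : Fin m → ℝ) (a : ℝ) {ℓ : ℝ}

lemma measurableSet_cube : MeasurableSet (cube c a ℓ) :=
  (MeasurableSet.univ_pi fun _ => measurableSet_Ioc).prod measurableSet_Ioc

lemma volume_pi_Ioc_prod (I : Set ℝ) :
    volume ((Set.univ.pi fun i => Set.Ioc (c i) (c i + ℓ)) ×ˢ I) =
      ENNReal.ofReal ℓ ^ m * volume I := by
  rw [Measure.volume_eq_prod, Measure.prod_prod, volume_pi_pi]
  simp

lemma volume_cube : volume (cube c a ℓ) = ENNReal.ofReal ℓ ^ m * ENNReal.ofReal ℓ := by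
  rw [cube, volume_pi_Ioc_prod]
  simp

lemma isProbabilityMeasure_cubeMeasure (hℓ : 0 < ℓ) :
    IsProbabilityMeasure (cubeMeasure c a ℓ) := by
  have h : ENNReal.ofReal ℓ ≠ 0 := by simpa using hℓ
  refine ⟨?_⟩
  rw [cubeMeasure, Measure.smul_apply, smul_eq_mul, Measure.restrict_apply_univ, volume_cube]
  exact ENNReal.inv_mul_cancel (mul_ne_zero (pow_ne_zero _ h) h)
    (ENNReal.mul_ne_top (by simp) (by simp))

lemma ae_mem_cube : ∀ᵐ x ∂cubeMeasure c a ℓ, x ∈ cube c a ℓ :=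
  Measure.ae_smul_measure (ae_restrict_mem (measurableSet_cube c a)) _

lemma cubeMeasure_real_snd_preimage_Icc_le (hℓ : 0 < ℓ) {r : ℝ} (hr : 0 ≤ r) :
    (cubeMeasure c a ℓ).real (Prod.snd ⁻¹' Set.Icc (-r) r) ≤ 2 * r / ℓ := by
  have h : ENNReal.ofReal ℓ ≠ 0 := by simpa using hℓ
  refine ENNReal.toReal_le_of_le_ofReal (by positivity) ?_
  rw [cubeMeasure, Measure.smul_apply, smul_eq_mul, Measure.restrict_apply_univ,
    Measure.restrict_apply (measurableSet_Icc.preimage measurable_snd), volume_cube]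
  have hsub : Prod.snd ⁻¹' Set.Icc (-r) r ∩ cube c a ℓ ⊆
      (Set.univ.pi fun i => Set.Ioc (c i) (c i + ℓ)) ×ˢ Set.Icc (-r) r :=
    fun x hx => ⟨hx.2.1, hx.1⟩
  have hvol := measure_mono (μ := volume) hsub
  rw [volume_pi_Ioc_prod, Real.volume_Icc, sub_neg_eq_add, ← two_mul] at hvol
  refine (mul_le_mul_right hvol _).trans_eq ?_
  rw [← ENNReal.div_eq_inv_mul, ENNReal.mul_div_mul_left _ _ (pow_ne_zero _ h) (by simp),
    ENNReal.ofReal_div_of_pos hℓ]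

variable {c a} in
lemma dist_le_of_mem_cube (hℓ : 0 < ℓ) {x y : (Fin m → ℝ) × ℝ} (hx : x ∈ cube c a ℓ)
    (hy : y ∈ cube c a ℓ) : dist x y ≤ ℓ := by
  have key : ∀ b s t : ℝ, s ∈ Set.Ioc b (b + ℓ) → t ∈ Set.Ioc b (b + ℓ) → dist s t ≤ ℓ := by
    intro b s t hs ht
    rw [Real.dist_eq, abs_le]
    constructor <;> linarith [hs.1, hs.2, ht.1, ht.2]
  exact max_le ((dist_pi_le_iff hℓ.le).2 fun i => key _ _ _ (hx.1 i trivial) (hy.1 i trivial))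
    (key _ _ _ hx.2 hy.2)

end Cube

/-- A product of a bounded Lipschitz function of `x'` with a bump rescaled to width `r⁻¹ ≤ 1` has
small mean oscillation on cubes of side much smaller or much larger than `r⁻¹`. -/
lemma meanOscillation_mul_rescaled_le {m : ℕ} {G : (Fin m → ℝ) → ℝ} {φ : ℝ → ℝ} {L K : NNReal}
    {M : ℝ} (hG : LipschitzWith L G) (hGM : ∀ x, |G x| ≤ M) (hφ : LipschitzWith K φ)
    (hφ1 : ∀ t, |φ t| ≤ 1) (hφ0 : ∀ t, 1 < |t| → φ t = 0) (c : Fin m → ℝ) (a : ℝ) {ℓ r : ℝ}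
    (hℓ : 0 < ℓ) (hr : 1 ≤ r) :
    Integrable (fun x : (Fin m → ℝ) × ℝ => G x.1 * φ (r * x.2)) (cubeMeasure c a ℓ) ∧
    meanOscillation (cubeMeasure c a ℓ) (fun x => G x.1 * φ (r * x.2)) ≤
      (L + M * K + 4 * M) * min (r * ℓ) (r * ℓ)⁻¹ := by
  have := isProbabilityMeasure_cubeMeasure c a hℓ
  have hM : 0 ≤ M := (abs_nonneg _).trans (hGM 0)
  have hr0 : 0 < r := by linarith
  have hcG := hG.continuous
  have hcφ := hφ.continuous
  have hbd : ∀ x : (Fin m → ℝ) × ℝ, |G x.1 * φ (r * x.2)| ≤ M := fun x => by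
    rw [abs_mul]
    exact (mul_le_mul (hGM _) (hφ1 _) (abs_nonneg _) hM).trans_eq (mul_one M)
  have hint : Integrable (fun x : (Fin m → ℝ) × ℝ => G x.1 * φ (r * x.2)) (cubeMeasure c a ℓ) :=
    Integrable.of_bound (by fun_prop : Continuous _).aestronglyMeasurable M
      (Filter.Eventually.of_forall hbd)
  refine ⟨hint, ?_⟩
  rw [mul_min_of_nonneg _ _ (by positivity)]
  refine le_min ?_ ?_
  · have h := meanOscillation_le_of_abs_sub_le hint (ae_mem_cube c a)
      (K := L * ℓ + M * (K * (r * ℓ))) fun x hx y hy => ?_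
    · refine h.trans ?_
      have h1 : L * ℓ ≤ L * (r * ℓ) := by gcongr; nlinarith
      have h2 : 0 ≤ 4 * M * (r * ℓ) := by positivity
      linarith
    · have hd := dist_le_of_mem_cube hℓ hx hy
      have hd1 : dist x.1 y.1 ≤ ℓ := (le_max_left _ _).trans hd
      have hd2 : dist x.2 y.2 ≤ ℓ := (le_max_right _ _).trans hd
      have e : G x.1 * φ (r * x.2) - G y.1 * φ (r * y.2) =
        (G x.1 - G y.1) * φ (r * x.2) + G y.1 * (φ (r * x.2) - φ (r * y.2)) := by ring
      rw [e]
      refine (abs_add_le _ _).trans ?_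
      rw [abs_mul, abs_mul]
      have h1 : |G x.1 - G y.1| ≤ L * ℓ := (hG.dist_le_mul _ _).trans (by gcongr)
      have h2 : |φ (r * x.2) - φ (r * y.2)| ≤ K * (r * ℓ) := by
        refine (hφ.dist_le_mul _ _).trans ?_
        rw [Real.dist_eq, ← mul_sub, abs_mul, abs_of_pos hr0, ← Real.dist_eq]
        gcongr
      refine add_le_add ?_ (mul_le_mul (hGM _) h2 (abs_nonneg _) hM)
      exact (mul_le_mul h1 (hφ1 _) (abs_nonneg _) (by positivity)).trans_eq (mul_one _)
  · have hS : MeasurableSet (Prod.snd ⁻¹' Set.Icc (-r⁻¹) r⁻¹ : Set ((Fin m → ℝ) × ℝ)) :=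
      measurableSet_Icc.preimage measurable_snd
    have h1 : ∫ x, |G x.1 * φ (r * x.2)| ∂cubeMeasure c a ℓ ≤ M * (2 * r⁻¹ / ℓ) := by
      calc _ ≤ ∫ x, (Prod.snd ⁻¹' Set.Icc (-r⁻¹) r⁻¹ : Set ((Fin m → ℝ) × ℝ)).indicator
              (fun _ => M) x ∂cubeMeasure c a ℓ := by
            refine integral_mono hint.abs ((integrable_const M).indicator hS) fun x => ?_
            by_cases hx : x ∈ (Prod.snd ⁻¹' Set.Icc (-r⁻¹) r⁻¹ : Set ((Fin m → ℝ) × ℝ))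
            · rw [Set.indicator_of_mem hx]
              exact hbd x
            · rw [Set.indicator_of_notMem hx]
              have : 1 < |r * x.2| := by
                rw [Set.mem_preimage, Set.mem_Icc, ← abs_le, not_le] at hx
                rw [abs_mul, abs_of_pos hr0]
                calc 1 = r * r⁻¹ := by field_simp
                  _ < _ := by gcongr
              simp [hφ0 _ this]
        _ = M * (cubeMeasure c a ℓ).real (Prod.snd ⁻¹' Set.Icc (-r⁻¹) r⁻¹) := by
            rw [integral_indicator_const _ hS, smul_eq_mul, mul_comm]
        _ ≤ _ := by
            gcongr
            exact cubeMeasure_real_snd_preimage_Icc_le c a hℓ (by positivity)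
    have h2 := meanOscillation_le_two_mul_integral_abs hint
    have e : 2 * (M * (2 * r⁻¹ / ℓ)) = 4 * M * (r * ℓ)⁻¹ := by
      field_simp
      ring
    have h3 : 0 ≤ (L + M * K) * (r * ℓ)⁻¹ := by positivity
    linarith

/-- Lemma 3.10: for any `ε > 0` and smooth compactly supported `g` on `ℝⁿ` (written as
`ℝ^{n-1} × ℝ`, `n ≥ 1`), there is a smooth compactly supported `ψ : ℝ → ℝ` with `0 ≤ ψ ≤ 1`,
`ψ(0) = 1` and `‖g(x',0) ψ(x_n)‖_{BMO(ℝⁿ)} < ε`. -/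
theorem exists_smooth_trace_small_bmo (m : ℕ) (ε : ℝ) (hε : 0 < ε)
    (g : (Fin m → ℝ) × ℝ → ℝ) (hg : ContDiff ℝ (⊤ : ℕ∞) g) (hgc : HasCompactSupport g) :
    ∃ ψ : ℝ → ℝ, ContDiff ℝ (⊤ : ℕ∞) ψ ∧ HasCompactSupport ψ ∧
      (∀ t, 0 ≤ ψ t ∧ ψ t ≤ 1) ∧ ψ 0 = 1 ∧
      (⨆ c : Fin m → ℝ, ⨆ a : ℝ, ⨆ ℓ : ℝ, ⨆ _ : 0 < ℓ,
        ⨍ x in (Set.univ.pi fun i => Set.Ioc (c i) (c i + ℓ)) ×ˢ Set.Ioc a (a + ℓ),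
          |g (x.1, 0) * ψ x.2 -
            ⨍ y in (Set.univ.pi fun i => Set.Ioc (c i) (c i + ℓ)) ×ˢ Set.Ioc a (a + ℓ),
              g (y.1, 0) * ψ y.2|) < ε := by
  obtain ⟨L, hL⟩ := hg.lipschitzWith_of_hasCompactSupport hgc (by simp)
  obtain ⟨M, hM⟩ := hgc.exists_bound_of_continuous hg.continuous
  let φ : ContDiffBump (0 : ℝ) := ⟨1 / 2, 1, by norm_num, by norm_num⟩
  have hφs : ContDiff ℝ (⊤ : ℕ∞) φ := φ.contDiff
  obtain ⟨K, hK⟩ := hφs.lipschitzWith_of_hasCompactSupport φ.hasCompactSupport (by simp)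
  have hφ1 : ∀ t, |φ t| ≤ 1 := fun t => by
    rw [abs_of_nonneg φ.nonneg]
    exact φ.le_one
  have hφ0 : ∀ t, 1 < |t| → φ t = 0 := fun t ht =>
    φ.zero_of_le_dist (by simpa [φ] using ht.le)
  have hG : LipschitzWith L fun x : Fin m → ℝ => g (x, 0) := by
    simpa [Function.comp_def] using hL.comp (LipschitzWith.prodMk_right (0 : ℝ))
  have hM0 : 0 ≤ M := (norm_nonneg _).trans (hM 0)
  set C : ℝ := L + M * K + 4 * M with hC
  have hC0 : 0 ≤ C := by positivity
  obtain ⟨n, hn⟩ := exists_nat_gt (C * 6 / ε)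
  have hn0 : (0 : ℝ) < n := lt_of_le_of_lt (by positivity) hn
  refine ⟨fun t => (n : ℝ)⁻¹ * ∑ k ∈ Finset.range n, φ (2 ^ k * t), ?_, ?_, ?_, ?_, ?_⟩
  · exact contDiff_const.mul (ContDiff.sum fun k _ => hφs.comp (contDiff_const.mul contDiff_id))
  · refine HasCompactSupport.intro (isCompact_Icc (a := (-1 : ℝ)) (b := 1)) fun t ht => ?_
    rw [Set.mem_Icc, ← abs_le, not_le] at ht
    rw [Finset.sum_eq_zero, mul_zero]
    intro k _
    refine hφ0 _ ?_
    rw [abs_mul, abs_of_pos (by positivity : (0 : ℝ) < 2 ^ k)]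
    nlinarith [one_le_pow₀ (one_le_two : (1 : ℝ) ≤ 2) (n := k)]
  · refine fun t => ⟨mul_nonneg (by positivity) (Finset.sum_nonneg fun _ _ => φ.nonneg), ?_⟩
    rw [inv_mul_le_iff₀ hn0, mul_one]
    calc _ ≤ ∑ k ∈ Finset.range n, (1 : ℝ) := Finset.sum_le_sum fun _ _ => φ.le_one
      _ = n := by simp
  · have : φ 0 = 1 := φ.one_of_mem_closedBall (by simp [φ])
    simp [this, hn0.ne']
  · refine lt_of_le_of_lt (b := (n : ℝ)⁻¹ * (C * 6)) ?_ ?_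
    · have hnn : 0 ≤ (n : ℝ)⁻¹ * (C * 6) := by positivity
      refine Real.iSup_le (fun c => Real.iSup_le (fun a => Real.iSup_le (fun ℓ =>
        Real.iSup_le (fun hℓ => ?_) hnn) hnn) hnn) hnn
      change meanOscillation (cubeMeasure c a ℓ) _ ≤ _
      have := isProbabilityMeasure_cubeMeasure c a hℓ
      have hF := fun k : ℕ => meanOscillation_mul_rescaled_le hG (fun x => hM (x, 0)) hK hφ1 hφ0 c a
        hℓ (one_le_pow₀ (one_le_two : (1 : ℝ) ≤ 2) (n := k))
      have h := meanOscillation_const_mul_sum_le (Finset.range n) _ (inv_nonneg.2 hn0.le)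
        fun k _ => (hF k).1
      refine (congrArg _ <| funext fun x => ?_).trans_le (h.trans ?_)
      · rw [mul_left_comm, Finset.mul_sum]
      gcongr
      calc _ ≤ ∑ k ∈ Finset.range n, C * min (2 ^ k * ℓ) (2 ^ k * ℓ)⁻¹ :=
            Finset.sum_le_sum fun k _ => (hF k).2
        _ = C * ∑ k ∈ Finset.range n, min (2 ^ k * ℓ) (2 ^ k * ℓ)⁻¹ := by rw [Finset.mul_sum]
        _ ≤ C * 6 := by
            gcongr
            exact sum_min_two_pow_mul_le n hℓ
    · rw [inv_mul_lt_iff₀ hn0]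
      rwa [div_lt_iff₀ hε] at hn
end
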